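/- Let a, b be positive divisors of N and let s be an integer divisible by b / gcd(N/a, b). Then the Gabor lattice Λ = { (a·m, s·m + b·n) : m, n ∈ ZMod N } ⊆ (ZMod N)², i.e. the image of the map (m,n) ↦ (a·m, s·m + b·n), has cardinality exactly N²/(a·b). In particular the redundancy R = N²/(|Λ|·1) = a·b/... equivalently |Λ| = N²/(ab) does not depend on the shear parameter s. -/

import Mathlib

theorem natCast_mul_inj_of_lt {N a A i j : ℕ} (ha : 0 < a) (hN : N = a * A)
    (hi : i < A) (hj : j < A) (h : (a : ZMod N) * i = (a : ZMod N) * j) : i = j := by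
  subst hN
  have h' : ((a * i : ℕ) : ZMod (a * A)) = ((a * j : ℕ) : ZMod (a * A)) := by
    push_cast
    exact h
  rw [ZMod.natCast_eq_natCast_iff] at h'
  exact (Nat.ModEq.mul_left_cancel' ha.ne' h').eq_of_lt_of_lt hi hj

theorem sheared_lattice_cardinality (N : ℕ) [NeZero N] (a b : ℕ)
    (ha : 0 < a) (hb : 0 < b) (haN : a ∣ N) (hbN : b ∣ N) (s : ℤ)
    (hs : ((b / Nat.gcd (N / a) b : ℕ) : ℤ) ∣ s) :
    (Finset.image
        (fun p : ZMod N × ZMod N =>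
          ((a : ZMod N) * p.1, (s : ZMod N) * p.1 + (b : ZMod N) * p.2))
        Finset.univ).card
      = N ^ 2 / (a * b) := by
  obtain ⟨A, hA⟩ := haN
  obtain ⟨B, hB⟩ := hbN
  have hN : 0 < N := Nat.pos_of_ne_zero (NeZero.ne N)
  have hA0 : 0 < A := Nat.pos_of_mul_pos_left (hA ▸ hN)
  have hB0 : 0 < B := Nat.pos_of_mul_pos_left (hB ▸ hN)
  have hNA : N / a = A := by rw [hA, Nat.mul_div_cancel_left _ ha]
  have hcast_a : (a : ZMod N) * A = 0 := by
    rw [← Nat.cast_mul, ← hA, ZMod.natCast_self]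
  have hcast_b : (b : ZMod N) * B = 0 := by
    rw [← Nat.cast_mul, ← hB, ZMod.natCast_self]
  obtain ⟨w, hw⟩ : (b : ℤ) ∣ s * A := by
    rw [hNA] at hs
    have hdvd : b ∣ (b / Nat.gcd A b) * A := by
      conv_lhs => rw [← Nat.div_mul_cancel (Nat.gcd_dvd_right A b)]
      exact Nat.mul_dvd_mul_left _ (Nat.gcd_dvd_left A b)
    exact (by exact_mod_cast hdvd : (b : ℤ) ∣ ((b / Nat.gcd A b : ℕ) : ℤ) * A).trans
      (mul_dvd_mul_right hs _)
  have hshear : (s : ZMod N) * A = b * w := by exact_mod_cast congrArg (Int.cast (R := ZMod N)) hw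
  have himage : Finset.image
        (fun p : ZMod N × ZMod N =>
          ((a : ZMod N) * p.1, (s : ZMod N) * p.1 + (b : ZMod N) * p.2))
        Finset.univ =
      Finset.image
        (fun p : ℕ × ℕ =>
          ((a : ZMod N) * (p.1 : ZMod N), (s : ZMod N) * (p.1 : ZMod N) + (b : ZMod N) * p.2))
        (Finset.range A ×ˢ Finset.range B) := by
    ext x
    simp only [Finset.mem_image, Finset.mem_univ, true_and, Finset.mem_product, Finset.mem_range]
    constructor
    · rintro ⟨⟨m, n⟩, rfl⟩
      obtain ⟨m, rfl⟩ := ZMod.natCast_zmod_surjective m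
      obtain ⟨n, rfl⟩ := ZMod.intCast_surjective n
      set z : ℤ := w * (m / A : ℕ) + n with hz
      have hB0' : (0 : ℤ) < B := by exact_mod_cast hB0
      have hj : ((z % B).toNat : ℤ) = z % B := Int.toNat_of_nonneg (Int.emod_nonneg _ hB0'.ne')
      have hm : (m : ZMod N) = (m % A : ℕ) + A * (m / A : ℕ) := by
        exact_mod_cast congrArg (Nat.cast (R := ZMod N)) (Nat.mod_add_div m A).symm
      have hzc : ((z % B).toNat : ZMod N) + B * (z / B : ℤ) = w * (m / A : ℕ) + n := by
        have h := Int.emod_add_mul_ediv z B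
        rw [← hj] at h
        have h' := congrArg (Int.cast (R := ZMod N)) (h.trans hz)
        simpa only [Int.cast_add, Int.cast_mul, Int.cast_natCast] using h'
      refine ⟨(m % A, (z % B).toNat), ⟨Nat.mod_lt _ hA0, ?_⟩, ?_⟩
      · have := Int.emod_lt_of_pos z hB0'
        dsimp only
        omega
      · ext1
        · dsimp only
          rw [hm]
          linear_combination (-((m / A : ℕ) : ZMod N)) * hcast_a
        · dsimp only
          rw [hm]
          linear_combination (b : ZMod N) * hzc - ((m / A : ℕ) : ZMod N) * hshear
            - ((z / B : ℤ) : ZMod N) * hcast_b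
    · rintro ⟨⟨i, j⟩, -, rfl⟩
      exact ⟨(i, j), rfl⟩
  rw [himage, Finset.card_image_of_injOn, Finset.card_product, Finset.card_range,
    Finset.card_range]
  · refine (Nat.div_eq_of_eq_mul_right (Nat.mul_pos ha hb) ?_).symm
    calc N ^ 2 = N * N := sq N
      _ = (a * A) * (b * B) := by rw [← hA, ← hB]
      _ = a * b * (A * B) := by ring
  · rintro ⟨i, j⟩ hij ⟨i', j'⟩ hij' h
    simp only [Finset.coe_product, Finset.coe_range, Set.mem_prod, Set.mem_Iio] at hij hij'
    simp only [Prod.mk.injEq] at h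
    obtain rfl := natCast_mul_inj_of_lt ha hA hij.1 hij'.1 h.1
    obtain rfl := natCast_mul_inj_of_lt hb hB hij.2 hij'.2 (add_left_cancel h.2)
    rfl
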